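/- Let a, A > 0, δ > 0 and t₀ < t with t − t₀ ≤ δ, and assume δ·(e^{(a/2)δ} − 1) ≤ a²/(4A). Then for every nonnegative integrable function Φ on [t₀, t]: A·δ·∫_{t₀}^t e^{-(a/2)(t−s)} (∫_{t₀}^s Φ(τ) dτ) ds ≤ (a/2)·∫_{t₀}^t e^{-(a/2)(t−s)} Φ(s) ds. -/

import Mathlib

open Set MeasureTheory intervalIntegral

theorem integral_exp_neg_mul_sub {c : ℝ} (hc : c ≠ 0) (t₀ t : ℝ) :
    ∫ s in t₀..t, Real.exp (-c * (t - s)) = (1 - Real.exp (-c * (t - t₀))) / c := by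
  have hderiv : ∀ s ∈ uIcc t₀ t,
      HasDerivAt (fun s => Real.exp (-c * (t - s)) / c) (Real.exp (-c * (t - s))) s := by
    intro s _
    have h := ((((hasDerivAt_id s).const_sub t).const_mul (-c)).exp).div_const c
    refine h.congr_deriv ?_
    simp [hc]
  rw [integral_eq_sub_of_hasDerivAt hderiv
    ((by fun_prop : Continuous fun s => Real.exp (-c * (t - s))).intervalIntegrable t₀ t)]
  simp [sub_div]

/-- An exponentially weighted integral of the primitive of a nonnegative function is controlled
by the total integral of that function. -/
theorem integral_exp_mul_primitive_le {c t₀ t : ℝ} (hc : 0 < c) (ht : t₀ ≤ t) {Φ : ℝ → ℝ}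
    (hΦ : ∀ s ∈ Icc t₀ t, 0 ≤ Φ s) (hint : IntervalIntegrable Φ volume t₀ t) :
    ∫ s in t₀..t, Real.exp (-c * (t - s)) * (∫ τ in t₀..s, Φ τ) ≤
      (1 - Real.exp (-c * (t - t₀))) / c * ∫ τ in t₀..t, Φ τ := by
  have hexp : Continuous fun s => Real.exp (-c * (t - s)) := by fun_prop
  have hprim : ContinuousOn (fun s => ∫ τ in t₀..s, Φ τ) (uIcc t₀ t) :=
    continuousOn_primitive_interval' hint left_mem_uIcc
  rw [← integral_exp_neg_mul_sub hc.ne', ← intervalIntegral.integral_mul_const]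
  refine integral_mono_on ht (hexp.continuousOn.mul hprim).intervalIntegrable
    ((hexp.mul continuous_const).intervalIntegrable _ _) fun s hs => ?_
  refine mul_le_mul_of_nonneg_left ?_ (Real.exp_pos _).le
  refine integral_mono_interval le_rfl hs.1 hs.2 ?_ hint
  exact (ae_restrict_iff' measurableSet_Ioc).2 <| .of_forall fun x hx => hΦ x (Ioc_subset_Icc_self hx)

/-- On `[t₀, t]` the weight `exp (-c * (t - s))` is at least its value at `s = t₀`. -/
theorem exp_mul_integral_le_integral_exp_mul {c t₀ t : ℝ} (hc : 0 ≤ c) (ht : t₀ ≤ t) {Φ : ℝ → ℝ}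
    (hΦ : ∀ s ∈ Icc t₀ t, 0 ≤ Φ s) (hint : IntervalIntegrable Φ volume t₀ t) :
    Real.exp (-c * (t - t₀)) * ∫ s in t₀..t, Φ s ≤
      ∫ s in t₀..t, Real.exp (-c * (t - s)) * Φ s := by
  have hexp : Continuous fun s => Real.exp (-c * (t - s)) := by fun_prop
  rw [← intervalIntegral.integral_const_mul]
  refine integral_mono_on ht (hint.const_mul _) (hint.continuousOn_mul hexp.continuousOn)
    fun s hs => ?_
  refine mul_le_mul_of_nonneg_right (Real.exp_le_exp.2 ?_) (hΦ s hs)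
  nlinarith [mul_nonneg hc (sub_nonneg.2 hs.1)]

/-- The key absorption step in the proof of the non-local Gronwall inequality:
for `δ` small enough relative to the decay rate `a` and the non-local coefficient `A`,
the non-local term can be absorbed into the exponentially weighted dissipative term. -/
theorem nonlocal_term_absorption
    (a A δ t₀ t : ℝ) (ha : 0 < a) (hA : 0 < A) (hδ : 0 < δ)
    (ht : t₀ < t) (htδ : t - t₀ ≤ δ)
    (hsmall : δ * (Real.exp ((a / 2) * δ) - 1) ≤ a ^ 2 / (4 * A)) :
    ∀ Φ : ℝ → ℝ, (∀ s ∈ Icc t₀ t, 0 ≤ Φ s) → IntervalIntegrable Φ volume t₀ t →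
      A * δ * (∫ s in t₀..t, Real.exp (-(a / 2) * (t - s)) * (∫ τ in t₀..s, Φ τ)) ≤
        (a / 2) * (∫ s in t₀..t, Real.exp (-(a / 2) * (t - s)) * Φ s) := by
  intro Φ hΦ hint
  have hc : 0 < a / 2 := by positivity
  set E := Real.exp (-(a / 2) * (t - t₀)) with hE
  have hEpos : 0 < E := Real.exp_pos _
  have hI : 0 ≤ ∫ s in t₀..t, Φ s := integral_nonneg ht.le hΦ
  have hcoef : A * δ * (1 - E) ≤ (a / 2) ^ 2 * E := by
    have hinv : E * Real.exp ((a / 2) * δ) ≥ 1 := by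
      rw [hE, ← Real.exp_add]
      exact Real.one_le_exp (by nlinarith)
    rw [le_div_iff₀ (by positivity)] at hsmall
    calc A * δ * (1 - E)
        ≤ A * δ * (E * Real.exp ((a / 2) * δ) - E) := by gcongr
      _ = δ * (Real.exp ((a / 2) * δ) - 1) * (4 * A) * (E / 4) := by ring
      _ ≤ a ^ 2 * (E / 4) := by gcongr
      _ = (a / 2) ^ 2 * E := by ring
  calc _ ≤ A * δ * ((1 - E) / (a / 2) * ∫ s in t₀..t, Φ s) := by
        gcongr
        exact integral_exp_mul_primitive_le hc ht.le hΦ hint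
    _ = A * δ * (1 - E) / (a / 2) * ∫ s in t₀..t, Φ s := by ring
    _ ≤ (a / 2) * E * ∫ s in t₀..t, Φ s := by
        gcongr
        rw [div_le_iff₀ hc]
        linarith
    _ = (a / 2) * (E * ∫ s in t₀..t, Φ s) := by ring
    _ ≤ _ := by
        gcongr
        exact exp_mul_integral_le_integral_exp_mul hc.le ht.le hΦ hint
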